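/- Let P be a string of length m and T a string, and let k' and j̄ be indices with 1 ≤ k' < m, j̄ + 1 < |T|, and j̄ − k' + m < |T|. If P[k'−1] = P[k'], T[j̄] ≠ T[j̄+1], and the prefix P[0..k'−1] of P of length k' is a suffix of T[0..j̄], then P does not occur in T starting at position j̄ − k' + 1, i.e., T[j̄−k'+1 .. j̄−k'+m] ≠ P. (This justifies that, in the run-length encoded BNDM algorithm, a window shift aligning a prefix of P that does not end at a run boundary of P can be safely skipped.) -/

import Mathlib

theorem stmt_11 {α : Type*} [Fintype α] (P T : List α) (k' jb : ℕ)
    (hk1 : 1 ≤ k') (hk2 : k' < P.length)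
    (hj1 : jb + 1 < T.length)
    (hj2 : jb + P.length - k' < T.length)
    (hP : P[k' - 1]'(by omega) = P[k']'hk2)
    (hT : T[jb]'(by omega) ≠ T[jb + 1]'hj1)
    (hpre : P.take k' <:+ T.take (jb + 1)) :
    (T.drop (jb + 1 - k')).take P.length ≠ P := by
  intro h
  have hlen := hpre.length_le
  simp only [List.length_take] at hlen
  have occ : ∀ i (hi : i < P.length), P[i]? = T[jb + 1 - k' + i]? := by
    intro i hi
    conv_lhs => rw [← h]
    rw [List.getElem?_take_of_lt hi, List.getElem?_drop]
  have h1 := occ (k' - 1) (by omega)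
  have h2 := occ k' hk2
  rw [show jb + 1 - k' + (k' - 1) = jb by omega] at h1
  rw [show jb + 1 - k' + k' = jb + 1 by omega] at h2
  rw [List.getElem?_eq_getElem (by omega), List.getElem?_eq_getElem (by omega)] at h1 h2
  exact hT ((Option.some.inj h1).symm.trans (hP.trans (Option.some.inj h2)))
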